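/- Let K ⊂ ℂ be a compact convex set with nonempty interior, and let u : ℂ → ℝ be continuous on K and harmonic on the interior of K (i.e., every point of the interior of K has an open ball around it on which u equals the real part of an analytic function). Then there exist a constant C ≥ 1 and a sequence of harmonic polynomials (h_n)_{n≥1}, where h_n(z) = Re(P_n(z)) for a complex polynomial P_n of degree at most n, such that sup_{z∈K} |u(z) − h_n(z)| ≤ C · E_n^h(u, K) for all n, and for every compact set E contained in the interior of K there exists c > 0 (depending on E) such that e^{c n} · sup_{z∈E} |u(z) − h_n(z)| → 0 as n → ∞. -/

import Mathlib

open Filter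

/-- Sup of `|u - Re P|` over a set `E`, where `Re P` is a harmonic polynomial. -/
noncomputable def supErrH (u : ℂ → ℝ) (E : Set ℂ) (P : Polynomial ℂ) : ℝ :=
  ⨆ z : E, |u z - (P.eval (z : ℂ)).re|

/-- `E_n^h(u, K)`: best uniform approximation error of `u` on `K` by harmonic
polynomials of degree at most `n` (real parts of complex polynomials). -/
noncomputable def bestEH (u : ℂ → ℝ) (K : Set ℂ) (n : ℕ) : ℝ :=
  ⨅ P : {P : Polynomial ℂ // P.natDegree ≤ n}, supErrH u K P.1


noncomputable def ccc (k : ℕ) : ℂ := (3 ^ (k+2) - 2 * 2 ^ (k+2) + 1) / ((k+2).factorial : ℂ)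

lemma ccc_bound (k : ℕ) : ‖ccc k‖ ≤ 36 * 3 ^ k / (k.factorial : ℝ) := by
  unfold ccc
  rw [norm_div]
  have h1 : ‖(3 ^ (k+2) - 2 * 2 ^ (k+2) + 1 : ℂ)‖ ≤ 36 * 3 ^ k := by
    have e : ‖(3 ^ (k+2) - 2 * 2 ^ (k+2) + 1 : ℂ)‖ ≤ 3 ^ (k+2) + 2 * 2 ^ (k+2) + 1 := by
      refine (norm_add_le _ _).trans ?_
      refine add_le_add ((norm_sub_le _ _).trans ?_) ?_ <;> simp
    have h2 : (2:ℝ) ^ k ≤ 3 ^ k := by gcongr; norm_num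
    have h3 : (1:ℝ) ≤ 3 ^ k := one_le_pow₀ (by norm_num)
    have h6 : (3:ℝ)^(k+2) = 9 * 3^k := by ring
    have h7 : (2:ℝ)^(k+2) = 4 * 2^k := by ring
    rw [h6, h7] at e
    linarith
  have h4 : (k.factorial : ℝ) ≤ ((k+2).factorial : ℝ) := by
    exact_mod_cast Nat.factorial_le (by omega)
  have h5 : (0:ℝ) < k.factorial := by positivity
  rw [Complex.norm_natCast]
  gcongr

lemma ccc_zero : ccc 0 = 1 := by
  norm_num [ccc, Nat.factorial]

lemma ccc_hasSum (z : ℂ) (hz : z ≠ 0) :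
    HasSum (fun k => ccc k * z ^ k) (Complex.exp z * ((Complex.exp z - 1) / z) ^ 2) := by
  have hE : ∀ a : ℂ, HasSum (fun k : ℕ => (a * z) ^ k / (k.factorial : ℂ)) (Complex.exp (a * z)) := by
    intro a
    rw [Complex.exp_eq_exp_ℂ]
    exact NormedSpace.expSeries_div_hasSum_exp (a * z)
  have h := (((hE 3).sub ((hE 2).mul_left 2)).add (hE 1))
  rw [← hasSum_nat_add_iff' 2] at h
  have h' := h.mul_left (1 / z ^ 2)
  convert! h' using 1
  · funext k
    unfold ccc
    have : ((k+2).factorial : ℂ) ≠ 0 := by exact_mod_cast Nat.factorial_ne_zero _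
    field_simp
    ring
  · have e3 : Complex.exp (3 * z) = Complex.exp z ^ 3 := by rw [← Complex.exp_nat_mul]; norm_num
    have e2 : Complex.exp (2 * z) = Complex.exp z ^ 2 := by rw [← Complex.exp_nat_mul]; norm_num
    rw [e3, e2]
    simp [Finset.sum_range_succ]
    field_simp
    ring

noncomputable def aaa (k : ℕ) : ℂ := - ccc k / k

lemma aaa_bound (k : ℕ) : ‖aaa k‖ ≤ 36 * 3 ^ k / (k.factorial : ℝ) := by
  refine le_trans ?_ (ccc_bound k)
  unfold aaa
  rcases Nat.eq_zero_or_pos k with rfl | hk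
  · simp
  · rw [norm_div, norm_neg, Complex.norm_natCast]
    exact div_le_self (norm_nonneg _) (by exact_mod_cast hk)

lemma sum_bound (r : ℝ) : Summable (fun k : ℕ => 36 * 3 ^ k / (k.factorial : ℝ) * r ^ k) := by
  have := (Real.summable_pow_div_factorial (3 * r)).mul_left 36
  refine this.congr fun k => ?_
  rw [mul_pow]; ring

lemma aaa_summable (z : ℂ) : Summable (fun k => aaa k * z ^ k) := by
  refine Summable.of_norm_bounded (sum_bound ‖z‖) fun k => ?_
  rw [norm_mul, norm_pow]
  have := aaa_bound k
  gcongr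

lemma HHH_deriv (z : ℂ) (hz : z ≠ 0) :
    HasDerivAt (fun w => ∑' k, aaa k * w ^ k)
      ((1 - Complex.exp z * ((Complex.exp z - 1) / z) ^ 2) / z) z := by
  have key := hasDerivAt_tsum_of_isPreconnected (𝕜 := ℂ) (F := ℂ) (g := fun k w => aaa k * w ^ k)
    (g' := fun k w => aaa k * (k * w ^ (k-1))) (t := Metric.ball 0 (‖z‖+1))
    (u := fun k : ℕ => 36 * 3 ^ k / (k.factorial : ℝ) * (‖z‖+1) ^ k) (y₀ := 0) (y := z)
    (sum_bound _) Metric.isOpen_ball (convex_ball _ _).isPreconnected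
    (fun k w _ => (hasDerivAt_pow k w).const_mul _) ?_ (by simp; positivity) (aaa_summable 0)
    (by simp)
  · convert! key using 1
    have h := (hasSum_nat_add_iff' 1).mpr (ccc_hasSum z hz)
    have h' := (h.mul_left (-1 / z))
    have h2 : HasSum (fun k => aaa k * (k * z ^ (k-1))) ((1 - Complex.exp z * ((Complex.exp z - 1) / z) ^ 2) / z) := by
      rw [← hasSum_nat_add_iff' 1]
      convert! h' using 1
      · funext k
        unfold aaa
        have : ((k + 1 : ℕ) : ℂ) ≠ 0 := by exact_mod_cast Nat.succ_ne_zero k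
        rw [Nat.add_sub_cancel]
        field_simp
        ring
      · simp [ccc_zero, aaa]
        ring
    exact h2.tsum_eq.symm
  · intro k w hw
    have hw' : ‖w‖ ≤ ‖z‖ + 1 := by simpa using (Metric.mem_ball.1 hw).le
    have e : ‖aaa k * (k * w ^ (k-1))‖ ≤ ‖ccc k‖ * (‖z‖+1)^k := by
      rcases Nat.eq_zero_or_pos k with rfl | hk
      · simp
      · have hk' : (k:ℂ) ≠ 0 := by exact_mod_cast hk.ne'
        have : aaa k * (k * w ^ (k-1)) = - (ccc k * w ^ (k-1)) := by
          unfold aaa; field_simp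
        rw [this, norm_neg, norm_mul, norm_pow]
        have : ‖w‖ ^ (k-1) ≤ (‖z‖+1) ^ k := by
          calc ‖w‖ ^ (k-1) ≤ (‖z‖+1)^(k-1) := by gcongr
            _ ≤ _ := pow_le_pow_right₀ (by linarith [norm_nonneg z]) (by omega)
        gcongr
    refine e.trans ?_
    have := ccc_bound k
    gcongr

noncomputable def DDD (z : ℂ) : ℂ := Complex.log (-z) - ∑' k, aaa k * z ^ k

lemma DDD_deriv (z : ℂ) (hz : -z ∈ Complex.slitPlane) :
    HasDerivAt DDD (Complex.exp z * ((Complex.exp z - 1) / z) ^ 2 / z) z := by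
  have hz0 : z ≠ 0 := by
    rintro rfl; simp at hz
  have h1 : HasDerivAt (fun w : ℂ => Complex.log (-w)) ((-1) / (-z)) z :=
    (hasDerivAt_neg z).clog hz
  have := h1.sub (HHH_deriv z hz0)
  convert! this using 1
  field_simp
  ring

lemma DDD_deriv_bound (z : ℂ) (hz : z ≠ 0) (h : z.re ≤ 4) :
    ‖Complex.exp z * ((Complex.exp z - 1) / z) ^ 2 / z‖ ≤
      (Real.exp 4 + 1)^2 * Real.exp z.re / ‖z‖ ^ 3 := by
  have h1 : ‖Complex.exp z - 1‖ ≤ Real.exp 4 + 1 := by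
    refine (norm_sub_le _ _).trans ?_
    rw [Complex.norm_exp]; simp [h]
  have hz' : 0 < ‖z‖ := norm_pos_iff.2 hz
  rw [norm_div, norm_mul, norm_pow, norm_div, Complex.norm_exp]
  have : Real.exp z.re * (‖Complex.exp z - 1‖ / ‖z‖)^2 / ‖z‖ = ‖Complex.exp z - 1‖^2 * Real.exp z.re / ‖z‖^3 := by
    field_simp
  rw [this]
  gcongr

/-- horizontal comparison -/
lemma DDD_horiz (z : ℂ) (m T : ℝ) (hm : 0 < m) (hT : 0 ≤ T) (hre : z.re ≤ 4)
    (hs : ∀ t : ℝ, 0 ≤ t → -(z - t) ∈ Complex.slitPlane ∧ m ≤ ‖z - t‖) :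
    ‖DDD z - DDD (z - T)‖ ≤ (Real.exp 4 + 1)^2 / m ^ 3 * Real.exp z.re := by
  set B : ℝ → ℝ := fun t => (Real.exp 4 + 1)^2 / m ^ 3 * Real.exp (z.re - T + t) with hB
  have hd : ∀ t : ℝ, t ≤ T → HasDerivAt (fun t : ℝ => DDD (z - T + t) - DDD (z - T))
      (Complex.exp (z - T + t) * ((Complex.exp (z - T + t) - 1) / (z - T + t)) ^ 2 / (z - T + t)) t := by
    intro t ht
    have h := (hs (T - t) (by linarith)).1
    have e : z - ((T - t : ℝ) : ℂ) = z - T + t := by push_cast; ring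
    rw [e] at h
    have h2 := (HasDerivAt.comp_const_add (z - T) (t : ℂ) (DDD_deriv _ h)).comp_ofReal
    exact h2.sub_const _
  have := image_norm_le_of_norm_deriv_right_le_deriv_boundary (a := 0) (b := T)
    (f := fun t : ℝ => DDD (z - T + t) - DDD (z - T)) (B := B) (B' := B)
    (fun t ht => (hd t ht.2).continuousAt.continuousWithinAt)
    (fun t ht => (hd t ht.2.le).hasDerivWithinAt) (by simp; positivity) ?_ ?_
    (x := T) ⟨hT, le_rfl⟩
  · simpa [hB] using this
  · intro t
    have := ((((hasDerivAt_id t).const_add (z.re - T)).exp).const_mul ((Real.exp 4 + 1)^2 / m ^ 3))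
    simpa [hB] using this
  · intro t ht
    have h := (hs (T - t) (by linarith [ht.2]))
    have e : z - ((T - t : ℝ) : ℂ) = z - T + t := by push_cast; ring
    rw [e] at h
    have h0 : z - T + t ≠ 0 := by
      rw [← norm_pos_iff]; linarith [h.2]
    have hr : (z - T + t).re = z.re - T + t := by simp
    refine (DDD_deriv_bound _ h0 (by rw [hr]; linarith [ht.2])).trans ?_
    rw [hr, hB]
    simp only
    rw [div_mul_eq_mul_div]
    gcongr
    exact h.2

lemma DDD_limit : ∃ L : ℂ, ∀ z : ℂ, Tendsto (fun m : ℕ => DDD (z - (m : ℝ))) atTop (nhds L) := by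
  have hmem : ∀ w : ℂ, w.re < 0 → -w ∈ Complex.slitPlane := by
    intro w hw; left; simpa using hw
  have hcauchy : CauchySeq (fun m : ℕ => DDD (-1 - (m : ℝ))) := by
    refine cauchySeq_of_le_tendsto_0 (fun N : ℕ => (Real.exp 4 + 1)^2 / 1 ^ 3 * Real.exp (-1 - N) * 2) ?_ ?_
    · intro n m N hn hm
      have key : ∀ n : ℕ, N ≤ n → ‖DDD (-1 - (N:ℝ)) - DDD (-1 - (n:ℝ))‖ ≤
          (Real.exp 4 + 1)^2 / 1 ^ 3 * Real.exp (-1 - N) := by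
        intro n hn
        have := DDD_horiz (-1 - (N:ℝ)) 1 (n - N) one_pos (by simpa using hn) (by simp; linarith) ?_
        · have e : (-1 - ((N:ℝ):ℂ) - ((n - N : ℝ):ℂ)) = -1 - ((n:ℝ):ℂ) := by push_cast; ring
          rw [e] at this
          simpa using this
        · intro t ht
          have hr : (-1 - ((N:ℝ):ℂ) - (t:ℂ)).re = -1 - N - t := by simp
          have hN : (0:ℝ) ≤ N := by positivity
          refine ⟨hmem _ (by rw [hr]; linarith), ?_⟩
          have := Complex.abs_re_le_norm (-1 - ((N:ℝ):ℂ) - (t:ℂ))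
          rw [hr, abs_of_nonpos (by linarith)] at this
          linarith
      have h1 := key n hn
      have h2 := key m hm
      rw [dist_eq_norm]
      calc _ = ‖(DDD (-1 - (N:ℝ)) - DDD (-1 - (m:ℝ))) - (DDD (-1 - (N:ℝ)) - DDD (-1 - (n:ℝ)))‖ := by congr 1; ring
        _ ≤ _ := (norm_sub_le _ _).trans (by linarith)
    · have : Tendsto (fun N : ℕ => Real.exp (-1 - N)) atTop (nhds 0) := by
        refine Real.tendsto_exp_atBot.comp ?_
        exact tendsto_atBot_add_const_left _ (-1) (tendsto_neg_atTop_atBot.comp tendsto_natCast_atTop_atTop)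
      have h := (this.const_mul ((Real.exp 4 + 1)^2 / 1 ^ 3)).mul_const 2
      simp only [mul_zero, zero_mul] at h
      exact h
  obtain ⟨L, hL⟩ := cauchySeq_tendsto_of_complete hcauchy
  refine ⟨L, fun z => ?_⟩
  have hdiff : Tendsto (fun m : ℕ => DDD (z - (m:ℝ)) - DDD (-1 - (m:ℝ))) atTop (nhds 0) := by
    rw [tendsto_zero_iff_norm_tendsto_zero]
    set A : ℝ := |z.re| + 1 with hA
    refine squeeze_zero' (g := fun m : ℕ => (Real.exp 4 + 1)^2 * Real.exp (A - m) * ‖z - (-1)‖) (Eventually.of_forall fun _ => norm_nonneg _) ?_ ?_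
    · obtain ⟨N, hN⟩ := exists_nat_gt (A + 1)
      filter_upwards [eventually_ge_atTop N] with m hm
      have hm' : (N:ℝ) ≤ m := by exact_mod_cast hm
      have hconv : Convex ℝ {w : ℂ | w.re ≤ A - m} := convex_halfSpace_re_le _
      have := hconv.norm_image_sub_le_of_norm_hasDerivWithin_le (f := DDD)
        (f' := fun w => Complex.exp w * ((Complex.exp w - 1) / w) ^ 2 / w)
        (C := (Real.exp 4 + 1)^2 * Real.exp (A - m)) (x := -1 - ((m:ℝ):ℂ)) (y := z - ((m:ℝ):ℂ))
        (fun w hw => (DDD_deriv w (hmem w (by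
          have : w.re ≤ A - m := hw
          linarith))).hasDerivWithinAt)
        (fun w hw => by
          have hw : w.re ≤ A - m := hw
          have h1 : w.re ≤ -1 := by linarith
          have h2 : 1 ≤ ‖w‖ := by
            have := Complex.abs_re_le_norm w
            rw [abs_of_nonpos (by linarith)] at this
            linarith
          refine (DDD_deriv_bound w (by rw [← norm_pos_iff]; linarith) (by linarith)).trans ?_
          refine (div_le_self (by positivity) (one_le_pow₀ h2)).trans ?_
          gcongr)
        (by simp [hA]; linarith [abs_nonneg z.re])
        (by simp [hA]; linarith [le_abs_self z.re])
      refine this.trans (le_of_eq ?_)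
      congr 2
      ring
    · have : Tendsto (fun N : ℕ => Real.exp (A - N)) atTop (nhds 0) := by
        refine Real.tendsto_exp_atBot.comp ?_
        exact tendsto_atBot_add_const_left _ A (tendsto_neg_atTop_atBot.comp tendsto_natCast_atTop_atTop)
      simpa using (this.const_mul ((Real.exp 4 + 1)^2)).mul_const ‖z - (-1)‖
  simpa using hdiff.add hL

lemma kernel_exists : ∃ (a : ℕ → ℂ) (C : ℝ), 0 ≤ C ∧ (∀ k, ‖a k‖ ≤ C * 3 ^ k / (k.factorial : ℝ)) ∧
    ∀ z : ℂ, z.re ≤ 4 → 8 ≤ ‖z‖ →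
      |Real.log ‖z‖ - (∑' k, a k * z ^ k).re| ≤ C * Real.exp z.re / ‖z‖ ^ 3 := by
  obtain ⟨L, hL⟩ := DDD_limit
  refine ⟨fun k => aaa k + (if k = 0 then L else 0), 36 + ‖L‖ + 8 * (Real.exp 4 + 1)^2, by positivity, ?_, ?_⟩
  · intro k
    refine (norm_add_le _ _).trans ?_
    have h1 := aaa_bound k
    have h2 : ‖(if k = 0 then L else 0 : ℂ)‖ ≤ ‖L‖ * 3 ^ k / (k.factorial : ℝ) := by
      split_ifs with h
      · subst h; simp
      · simp; positivity
    have h3 : 0 ≤ 8 * (Real.exp 4 + 1)^2 * 3 ^ k / (k.factorial : ℝ) := by positivity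
    calc _ ≤ _ := add_le_add h1 h2
      _ ≤ _ := by
        have : (36 + ‖L‖ + 8 * (Real.exp 4 + 1)^2) * 3 ^ k / (k.factorial : ℝ) = 36 * 3 ^ k / (k.factorial : ℝ) + ‖L‖ * 3 ^ k / (k.factorial : ℝ) + 8 * (Real.exp 4 + 1)^2 * 3 ^ k / (k.factorial : ℝ) := by ring
        rw [this]; linarith
  · intro z hre hz
    have hsum : (∑' k, (aaa k + (if k = 0 then L else 0)) * z ^ k) = (∑' k, aaa k * z ^ k) + L := by
      have h2 : HasSum (fun k : ℕ => (if k = 0 then L else 0) * z ^ k) L := by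
        have := hasSum_single (f := fun k : ℕ => (if k = 0 then L else 0) * z ^ k) 0 (by
          intro b hb; simp [hb])
        simpa using this
      have := (aaa_summable z).hasSum.add h2
      rw [← this.tsum_eq]
      congr 1
      funext k
      ring
    have hns : ‖z‖ ^ 2 = z.re ^ 2 + z.im ^ 2 := by
      rw [← Complex.normSq_eq_norm_sq, Complex.normSq_apply]; ring
    have hs : ∀ t : ℝ, 0 ≤ t → -(z - t) ∈ Complex.slitPlane ∧ ‖z‖ / 2 ≤ ‖z - t‖ := by
      intro t ht
      have hns2 : ‖z - t‖ ^ 2 = (z.re - t) ^ 2 + z.im ^ 2 := by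
        rw [← Complex.normSq_eq_norm_sq, Complex.normSq_apply]; simp; ring
      rcases le_or_gt z.re 0 with h0 | h0
      · have : ‖z‖ ≤ ‖z - t‖ := by
          rw [← sq_le_sq₀ (norm_nonneg _) (norm_nonneg _), hns, hns2]; nlinarith
        refine ⟨?_, by linarith [norm_nonneg z]⟩
        by_cases him : z.im = 0
        · left
          have : z.re ≠ 0 := by
            intro h; rw [h, him] at hns; nlinarith
          have : z.re < 0 := lt_of_le_of_ne h0 this
          simp; linarith
        · right; simpa using him
      · have him : 3 / 4 * ‖z‖ ^ 2 ≤ z.im ^ 2 := by nlinarith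
        refine ⟨?_, ?_⟩
        · right
          have : z.im ≠ 0 := by intro h; rw [h] at him; nlinarith
          simpa using this
        · rw [← sq_le_sq₀ (by positivity) (norm_nonneg _), hns2]
          nlinarith [sq_nonneg (z.re - t)]
    have hb : ∀ m : ℕ, ‖DDD z - DDD (z - (m:ℝ))‖ ≤ (Real.exp 4 + 1)^2 / (‖z‖/2) ^ 3 * Real.exp z.re :=
      fun m => DDD_horiz z (‖z‖/2) m (by linarith) (by positivity) hre hs
    have hlim := le_of_tendsto ((tendsto_const_nhds.sub (hL z)).norm) (Eventually.of_forall hb)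
    rw [hsum]
    have e : Real.log ‖z‖ - ((∑' k, aaa k * z ^ k) + L).re = (DDD z - L).re := by
      simp [DDD, Complex.log_re]; ring
    rw [e]
    refine (Complex.abs_re_le_norm _).trans (hlim.trans ?_)
    have hz0 : 0 < ‖z‖ := by linarith
    have : (Real.exp 4 + 1)^2 / (‖z‖/2) ^ 3 * Real.exp z.re = 8 * (Real.exp 4 + 1)^2 * Real.exp z.re / ‖z‖^3 := by
      field_simp; ring
    rw [this]
    gcongr
    linarith [norm_nonneg L]

open MeasureTheory in
lemma log_int (z : ℂ) (R : ℝ) : IntegrableOn (fun w : ℂ => Real.log ‖w - z‖) (Metric.ball 0 R) := by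
  have h0 : ∀ R : ℝ, IntegrableOn (fun w : ℂ => Real.log ‖w‖) (Metric.ball 0 R) := by
    intro R
    rw [integrableOn_fun_norm_addHaar volume (f := Real.log)]
    have hc : Continuous fun y : ℝ => y * Real.log y := Real.continuous_mul_log
    have := (hc.integrableOn_Icc (μ := volume) (a := 0) (b := R)).mono_set Set.Ioo_subset_Icc_self
    simpa [Complex.finrank_real_complex] using this
  have h1 := h0 (R + ‖z‖)
  have hmp : MeasurePreserving (fun w : ℂ => w - z) volume volume := measurePreserving_sub_right _ _
  have hme : MeasurableEmbedding (fun w : ℂ => w - z) := (MeasurableEquiv.subRight z).measurableEmbedding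
  have h2 := (hmp.integrableOn_comp_preimage hme).2 h1
  refine h2.mono_set ?_
  intro w hw
  simp only [Set.mem_preimage, mem_ball_zero_iff] at hw ⊢
  linarith [norm_sub_le w z]

noncomputable def lr (r : ℝ) (y : ℂ) : ℝ := Real.log r + Real.posLog (r⁻¹ * ‖y‖)

open MeasureTheory in
lemma circ_meas (f : ℂ → ℝ) (hf : Measurable f) (r : ℝ) :
    Measurable (fun w => Real.circleAverage f w r) := by
  unfold Real.circleAverage
  simp only [intervalIntegral.integral_of_le Real.two_pi_pos.le]
  simp only [smul_eq_mul]
  refine Measurable.const_mul ?_ _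
  refine StronglyMeasurable.measurable ?_
  refine StronglyMeasurable.integral_prod_right (f := fun (w : ℂ) (θ : ℝ) => f (circleMap w r θ)) ?_
  refine (hf.comp ?_).stronglyMeasurable
  have : Continuous (fun x : ℂ × ℝ => circleMap x.1 r x.2) := by
    unfold circleMap; fun_prop
  exact this.measurable

lemma circ_bound (f : ℂ → ℝ) (r M : ℝ) (hM : ∀ w, |f w| ≤ M) (w : ℂ) :
    |Real.circleAverage f w r| ≤ M := by
  unfold Real.circleAverage
  have := intervalIntegral.norm_integral_le_of_norm_le_const (a := 0) (b := 2 * Real.pi) (C := M)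
    (f := fun θ => f (circleMap w r θ)) (fun θ _ => hM _)
  rw [smul_eq_mul, abs_mul, abs_of_nonneg (by positivity)]
  have hp := Real.two_pi_pos
  rw [sub_zero, abs_of_pos hp, Real.norm_eq_abs] at this
  rw [inv_mul_le_iff₀ hp]; linarith

open MeasureTheory in
lemma fub (f : ℂ → ℝ) (hf : Measurable f) (M R r : ℝ) (hr : 0 < r) (hM : ∀ w, |f w| ≤ M)
    (hsupp : ∀ w, R ≤ ‖w‖ → f w = 0) (z : ℂ) :
    ∫ y, f (z + y) * lr r y = ∫ w, Real.log ‖w - z‖ * Real.circleAverage f w r := by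
  set ν : Measure ℝ := volume.restrict (Set.Ioc 0 (2 * Real.pi)) with hν
  have hcm : Measurable (fun x : ℝ × ℂ => circleMap x.2 r x.1) := by
    have : Continuous (fun x : ℝ × ℂ => circleMap x.2 r x.1) := by
      unfold circleMap; fun_prop
    exact this.measurable
  have hint1 : Integrable (fun p : ℝ × ℂ => Real.log ‖p.2 - z‖ * f (circleMap p.2 r p.1))
      (ν.prod volume) := by
    have hg : Integrable (fun w : ℂ => (Metric.ball 0 (R + r)).indicator (fun w : ℂ => Real.log ‖w - z‖) w) :=
      (integrable_indicator_iff Metric.isOpen_ball.measurableSet).2 (log_int z (R + r))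
    have hg2 := (hg.norm.mul_const M).comp_snd ν
    refine hg2.mono' ?_ ?_
    · refine (Measurable.mul ?_ (hf.comp hcm)).aestronglyMeasurable
      fun_prop
    · refine Eventually.of_forall fun p => ?_
      have hM0 : 0 ≤ M := (abs_nonneg _).trans (hM 0)
      by_cases hp : p.2 ∈ Metric.ball (0:ℂ) (R + r)
      · simp only [Set.indicator_of_mem hp, norm_mul]
        gcongr
        exact hM _
      · have : f (circleMap p.2 r p.1) = 0 := by
          apply hsupp
          have h1 : R + r ≤ ‖p.2‖ := by simpa using hp
          have h2 : circleMap p.2 r p.1 = p.2 + circleMap 0 r p.1 := by simp [circleMap]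
          have h3 : ‖circleMap 0 r p.1‖ = r := by simp [abs_of_pos hr]
          have h4 := norm_sub_le_norm_add p.2 (circleMap 0 r p.1)
          rw [h2]; linarith
        rw [this]; simp; positivity
  have hmp : MeasurePreserving (fun p : ℝ × ℂ => (id p.1, z + p.2 - circleMap 0 r p.1))
      (ν.prod volume) (ν.prod volume) := by
    refine MeasurePreserving.skew_product (MeasurePreserving.id ν)
      (g := fun (θ : ℝ) (y : ℂ) => z + y - circleMap 0 r θ) ?_ ?_
    · have : Continuous (fun p : ℝ × ℂ => z + p.2 - circleMap 0 r p.1) := by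
        unfold circleMap; fun_prop
      exact this.measurable
    · refine Eventually.of_forall fun θ => ?_
      have : (fun y => z + y - circleMap 0 r θ) = fun y => (z - circleMap 0 r θ) + y := by
        funext y; ring
      rw [this]
      exact (measurePreserving_add_left volume _).map_eq
  have hint2 : Integrable (fun p : ℝ × ℂ => Real.log ‖p.2 - circleMap 0 r p.1‖ * f (z + p.2))
      (ν.prod volume) := by
    have := hmp.integrable_comp_of_integrable hint1
    refine this.congr (Eventually.of_forall fun p => ?_)
    simp only [Function.comp, id]
    have e1 : z + p.2 - circleMap 0 r p.1 - z = p.2 - circleMap 0 r p.1 := by ring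
    have e2 : circleMap (z + p.2 - circleMap 0 r p.1) r p.1 = z + p.2 := by
      simp [circleMap]
    rw [e1, e2]
  have hA : ∫ w, Real.log ‖w - z‖ * Real.circleAverage f w r =
      (2 * Real.pi)⁻¹ * ∫ θ, ∫ w, Real.log ‖w - z‖ * f (circleMap w r θ) ∂volume ∂ν := by
    rw [integral_integral_swap hint1, ← integral_const_mul]
    congr 1; funext w
    rw [integral_const_mul, Real.circleAverage, intervalIntegral.integral_of_le Real.two_pi_pos.le]
    simp only [smul_eq_mul, hν]; ring
  have hB : ∫ y, f (z + y) * lr r y =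
      (2 * Real.pi)⁻¹ * ∫ θ, ∫ y, Real.log ‖y - circleMap 0 r θ‖ * f (z + y) ∂volume ∂ν := by
    rw [integral_integral_swap hint2, ← integral_const_mul]
    congr 1; funext y
    rw [integral_mul_const]
    have h := circleAverage_log_norm_sub_const_eq_log_radius_add_posLog (a := y) (c := 0) hr.ne'
    rw [zero_sub, norm_neg] at h
    rw [lr, ← h, Real.circleAverage, intervalIntegral.integral_of_le Real.two_pi_pos.le]
    simp only [smul_eq_mul, hν, norm_sub_rev y]; ring
  rw [hA, hB]
  congr 2
  funext θ
  rw [← integral_add_left_eq_self (fun w => Real.log ‖w - z‖ * f (circleMap w r θ)) (z - circleMap 0 r θ)]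
  congr 1; funext y
  have e1 : z - circleMap 0 r θ + y - z = y - circleMap 0 r θ := by ring
  have e2 : circleMap (z - circleMap 0 r θ + y) r θ = z + y := by
    simp [circleMap]; ring
  rw [e1, e2]

noncomputable def phi (y : ℂ) : ℝ := lr 2 y - lr 1 y

lemma lr_cont (r : ℝ) : Continuous (lr r) := by
  unfold lr
  have : Continuous Real.posLog := by fun_prop
  fun_prop

lemma phi_zero (y : ℂ) (hy : 2 ≤ ‖y‖) : phi y = 0 := by
  unfold phi lr
  rw [Real.posLog_eq_log, Real.posLog_eq_log, Real.log_mul, Real.log_mul]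
  · simp
  · norm_num
  · linarith
  · norm_num
  · linarith
  · rw [abs_of_nonneg (by positivity)]; linarith
  · rw [abs_of_nonneg (by positivity)]; linarith

lemma phi_nonneg (y : ℂ) : 0 ≤ phi y := by
  rcases le_or_gt 2 ‖y‖ with h | h
  · rw [phi_zero y h]
  · unfold phi lr
    have h1 : 0 ≤ Real.posLog (2⁻¹ * ‖y‖) := Real.posLog_nonneg
    have h2 : Real.posLog (1⁻¹ * ‖y‖) ≤ Real.log 2 := by
      have : Real.posLog (1⁻¹ * ‖y‖) ≤ Real.posLog 2 :=
        Real.posLog_le_posLog (by positivity) (by linarith)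
      rwa [Real.posLog_eq_log (x := 2) (by norm_num)] at this
    simp only [Real.log_one, zero_add]; linarith

open MeasureTheory in
lemma phi_int : Integrable phi := by
  have hc : Continuous phi := (lr_cont 2).sub (lr_cont 1)
  refine hc.integrable_of_hasCompactSupport ?_
  refine HasCompactSupport.of_support_subset_isCompact (isCompact_closedBall (0:ℂ) 2) ?_
  intro y hy
  by_contra h
  apply hy
  apply phi_zero
  simp at h
  exact h.le

open MeasureTheory in
lemma phi_pos : 0 < ∫ y, phi y := by
  have hc : Continuous phi := (lr_cont 2).sub (lr_cont 1)
  have h0 : phi 0 ≠ 0 := by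
    simp [phi, lr]
    norm_num
  exact hc.integral_pos_of_hasCompactSupport_nonneg_nonzero (x := 0) (HasCompactSupport.of_support_subset_isCompact (isCompact_closedBall (0:ℂ) 2) (by
    intro y hy
    by_contra h
    apply hy
    apply phi_zero
    simp at h
    exact h.le)) phi_nonneg h0

lemma phi_norm (y y' : ℂ) (h : ‖y‖ = ‖y'‖) : phi y = phi y' := by
  simp [phi, lr, h]

open MeasureTheory in
lemma meanphi (f : ℂ → ℝ) (hf : Measurable f) (M : ℝ) (hM : ∀ w, |f w| ≤ M) (z : ℂ)
    (hmv : ∀ r, 0 ≤ r → r ≤ 2 → Real.circleAverage f z r = f z) :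
    ∫ y, f (z + y) * phi y = f z * ∫ y, phi y := by
  have hpm : Measurable phi := ((lr_cont 2).sub (lr_cont 1)).measurable
  set ν : Measure ℝ := volume.restrict (Set.Ioc 0 (2 * Real.pi)) with hν
  have hrot : ∀ θ : ℝ, ∫ y, f (z + y) * phi y = ∫ y, f (z + Complex.exp (θ * Complex.I) * y) * phi y := by
    intro θ
    have hmp := (rotation (Circle.exp θ)).measurePreserving
    have := hmp.integral_comp (rotation (Circle.exp θ)).toHomeomorph.measurableEmbedding
      (fun y => f (z + y) * phi y)
    rw [← this]
    congr 1; funext y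
    rw [phi_norm _ y (LinearIsometryEquiv.norm_map _ _)]
    simp [rotation_apply]
  have hcont : Continuous (fun p : ℝ × ℂ => z + Complex.exp (p.1 * Complex.I) * p.2) := by fun_prop
  have hint : Integrable (fun p : ℝ × ℂ => f (z + Complex.exp (p.1 * Complex.I) * p.2) * phi p.2)
      (ν.prod volume) := by
    have hg := (phi_int.norm.const_mul M).comp_snd ν
    refine hg.mono' ?_ ?_
    · exact ((hf.comp hcont.measurable).mul (hpm.comp measurable_snd)).aestronglyMeasurable
    · refine Eventually.of_forall fun p => ?_
      rw [norm_mul]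
      gcongr
      exact hM _
  have h1 : ∫ θ, ∫ y, f (z + Complex.exp (θ * Complex.I) * y) * phi y ∂volume ∂ν =
      (2 * Real.pi) * ∫ y, f (z + y) * phi y := by
    simp only [← hrot]
    rw [integral_const]
    simp [hν, Real.two_pi_pos.le]
  rw [integral_integral_swap hint] at h1
  have h2 : ∀ y : ℂ, ∫ θ, f (z + Complex.exp (θ * Complex.I) * y) * phi y ∂ν = 2 * Real.pi * (f z * phi y) := by
    intro y
    rw [integral_mul_const]
    rcases le_or_gt 2 ‖y‖ with h | h
    · rw [phi_zero y h]; simp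
    · have hm := hmv ‖y‖ (norm_nonneg _) h.le
      have e : ∀ θ : ℝ, f (z + Complex.exp (θ * Complex.I) * y) = f (circleMap z ‖y‖ (θ + Complex.arg y)) := by
        intro θ
        congr 1
        unfold circleMap
        congr 1
        conv_lhs => rw [← Complex.norm_mul_exp_arg_mul_I y]
        push_cast
        rw [add_mul, Complex.exp_add]; ring
      simp only [e]
      have per : Function.Periodic (fun θ => f (circleMap z ‖y‖ θ)) (2 * Real.pi) := by
        intro θ; simp [periodic_circleMap z ‖y‖ θ]
      have h3 : ∫ θ, f (circleMap z ‖y‖ (θ + Complex.arg y)) ∂ν = ∫ θ in (0:ℝ)..(2 * Real.pi), f (circleMap z ‖y‖ θ) := by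
        rw [hν, ← intervalIntegral.integral_of_le Real.two_pi_pos.le,
          intervalIntegral.integral_comp_add_right (fun θ => f (circleMap z ‖y‖ θ))]
        have := per.intervalIntegral_add_eq (Complex.arg y) 0
        rw [zero_add] at this ⊢
        rw [← this, add_comm (Complex.arg y)]
      rw [h3]
      rw [Real.circleAverage, smul_eq_mul, inv_mul_eq_iff_eq_mul₀ Real.two_pi_pos.ne'] at hm
      rw [hm]; ring
  simp only [h2] at h1
  rw [integral_const_mul, integral_const_mul] at h1
  exact (mul_left_cancel₀ Real.two_pi_pos.ne' h1).symm

lemma kern_summable (a : ℕ → ℂ) (C : ℝ) (ha : ∀ k, ‖a k‖ ≤ C * 3 ^ k / (k.factorial : ℝ)) (z : ℂ) :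
    Summable (fun k => a k * z ^ k) := by
  have hs := (Real.summable_pow_div_factorial (3 * ‖z‖)).mul_left C
  refine Summable.of_norm_bounded hs fun k => ?_
  rw [norm_mul, norm_pow]
  calc _ ≤ C * 3 ^ k / (k.factorial : ℝ) * ‖z‖ ^ k := by gcongr; exact ha k
    _ = _ := by rw [mul_pow]; ring

lemma kern_tail (a : ℕ → ℂ) (C : ℝ) (hC : 0 ≤ C)
    (ha : ∀ k, ‖a k‖ ≤ C * 3 ^ k / (k.factorial : ℝ)) (z : ℂ) (n : ℕ) :
    ‖(∑' k, a k * z ^ k) - ∑ k ∈ Finset.range n, a k * z ^ k‖ ≤ C * Real.exp (-n) * Real.exp (9 * ‖z‖) := by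
  have hs := kern_summable a C ha z
  rw [← hs.sum_add_tsum_nat_add n, add_sub_cancel_left]
  have hexp : ∀ x : ℝ, HasSum (fun k : ℕ => x ^ k / (k.factorial : ℝ)) (Real.exp x) := by
    intro x
    rw [Real.exp_eq_exp_ℝ]
    exact NormedSpace.expSeries_div_hasSum_exp x
  have hg := (hexp (9 * ‖z‖)).mul_left (C * Real.exp (-n))
  have hg' : Summable (fun k : ℕ => C * Real.exp (-n) * ((9 * ‖z‖) ^ (k+n) / ((k+n).factorial : ℝ))) :=
    (summable_nat_add_iff n).2 hg.summable
  refine (tsum_of_norm_bounded hg'.hasSum fun k => ?_).trans ?_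
  · rw [norm_mul, norm_pow]
    have h1 : (3:ℝ) ^ (k+n) ≤ Real.exp (-n) * 9 ^ (k+n) := by
      have h2 : Real.exp n ≤ 3 ^ (k+n) := by
        calc Real.exp n = Real.exp 1 ^ n := by rw [← Real.exp_nat_mul]; simp
          _ ≤ 3 ^ n := by gcongr; linarith [Real.exp_one_lt_d9]
          _ ≤ 3 ^ (k+n) := pow_le_pow_right₀ (by norm_num) (by omega)
      have h3 : (9:ℝ) ^ (k+n) = 3 ^ (k+n) * 3 ^ (k+n) := by rw [← mul_pow]; norm_num
      rw [h3, ← mul_assoc, Real.exp_neg]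
      refine le_mul_of_one_le_left (by positivity) ?_
      rw [inv_mul_eq_div, one_le_div (Real.exp_pos _)]; exact h2
    calc _ ≤ C * 3 ^ (k+n) / ((k+n).factorial : ℝ) * ‖z‖ ^ (k+n) := by gcongr; exact ha _
      _ ≤ C * (Real.exp (-n) * 9 ^ (k+n)) / ((k+n).factorial : ℝ) * ‖z‖ ^ (k+n) := by gcongr
      _ = _ := by rw [mul_pow]; ring
  · have h5 := hg.summable.sum_add_tsum_nat_add n
    rw [hg.tsum_eq] at h5
    have h6 : 0 ≤ ∑ i ∈ Finset.range n, C * Real.exp (-n) * ((9 * ‖z‖) ^ i / (i.factorial : ℝ)) :=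
      Finset.sum_nonneg fun i _ => by positivity
    linarith

open MeasureTheory in
lemma intg {E : Type*} [NormedAddCommGroup E] [NormedSpace ℝ E] (g : ℂ → E) (m : ℂ → ℝ) (ρ B : ℝ)
    (hg : IntegrableOn g (Metric.ball 0 ρ)) (hm : Measurable m) (hB : ∀ w, |m w| ≤ B)
    (hs : ∀ w, ρ ≤ ‖w‖ → m w = 0) : Integrable (fun w => m w • g w) := by
  have h1 : IntegrableOn (fun w => m w • g w) (Metric.ball 0 ρ) := by
    refine Integrable.mono' (hg.norm.const_mul B) ?_ ?_
    · exact hm.aestronglyMeasurable.smul hg.aestronglyMeasurable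
    · refine Eventually.of_forall fun w => ?_
      rw [norm_smul]
      gcongr
      exact hB w
  rw [← integrable_indicator_iff Metric.isOpen_ball.measurableSet] at h1
  refine h1.congr (Eventually.of_forall fun w => ?_)
  by_cases hw : w ∈ Metric.ball (0:ℂ) ρ
  · simp [Set.indicator_of_mem hw]
  · have : m w = 0 := hs w (by simpa using hw)
    simp [this]

open MeasureTheory in
lemma intg_bdd (g : ℂ → ℂ) (m : ℂ → ℝ) (ρ B G : ℝ)
    (hg : Measurable g) (hG : ∀ w, ‖w‖ < ρ → ‖g w‖ ≤ G) (hm : Measurable m) (hB : ∀ w, |m w| ≤ B)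
    (hs : ∀ w, ρ ≤ ‖w‖ → m w = 0) : Integrable (fun w => m w • g w) := by
  refine intg g m ρ B ?_ hm hB hs
  refine Measure.integrableOn_of_bounded (M := G) ?_ hg.aestronglyMeasurable ?_
  · exact measure_ball_lt_top.ne
  · refine (ae_restrict_iff' Metric.isOpen_ball.measurableSet).2 (Eventually.of_forall fun w hw => hG w ?_)
    simpa using hw

open MeasureTheory in
lemma poly_int1 (N : ℂ → ℂ) (hN : Measurable N) (hN1 : ∀ w, ‖N w‖ = 1) (m : ℂ → ℝ) (ρ B : ℝ)
    (hm : Measurable m) (hB : ∀ w, |m w| ≤ B) (hs : ∀ w, ρ ≤ ‖w‖ → m w = 0) (k : ℕ) :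
    ∃ P : Polynomial ℂ, P.natDegree ≤ k ∧ ∀ z, P.eval z = ∫ w, m w • (N w * (z - w)) ^ k := by
  refine ⟨∑ j ∈ Finset.range (k+1), Polynomial.monomial j
    (∫ w, m w • (N w ^ k * (-w) ^ (k - j) * (k.choose j : ℂ))), ?_, ?_⟩
  · refine Polynomial.natDegree_sum_le_of_forall_le _ _ fun j hj => ?_
    refine (Polynomial.natDegree_monomial_le _).trans ?_
    have := Finset.mem_range.1 hj; omega
  · intro z
    rw [Polynomial.eval_finsetSum]
    simp only [Polynomial.eval_monomial]
    simp only [← integral_mul_const]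
    rw [← integral_finsetSum]
    · congr 1; funext w
      rw [mul_pow, sub_eq_add_neg, add_pow, Finset.mul_sum, Finset.smul_sum]
      refine Finset.sum_congr rfl fun j _ => ?_
      rw [smul_mul_assoc]; congr 1; ring
    · intro j _
      refine Integrable.mul_const ?_ _
      refine intg_bdd _ m ρ B (ρ ^ (k-j) * (k.choose j : ℝ)) ?_ ?_ hm hB hs
      · fun_prop
      · intro w hw
        rw [norm_mul, norm_mul, norm_pow, norm_pow, hN1, norm_neg, one_pow, one_mul, Complex.norm_natCast]
        gcongr

open MeasureTheory in
lemma poly_int (a : ℕ → ℂ) (n : ℕ) (N : ℂ → ℂ) (hN : Measurable N) (hN1 : ∀ w, ‖N w‖ = 1) (m : ℂ → ℝ) (ρ B : ℝ)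
    (hm : Measurable m) (hB : ∀ w, |m w| ≤ B) (hs : ∀ w, ρ ≤ ‖w‖ → m w = 0) :
    (∃ P : Polynomial ℂ, P.natDegree ≤ n ∧ ∀ z, P.eval z =
      ∫ w, m w • ∑ k ∈ Finset.range (n+1), a k * (N w * (z - w)) ^ k) ∧
    ∀ z, Integrable (fun w => m w • ∑ k ∈ Finset.range (n+1), a k * (N w * (z - w)) ^ k) := by
  have hi : ∀ (z : ℂ) (k : ℕ), Integrable (fun w => m w • (N w * (z - w)) ^ k) := by
    intro z k
    refine intg_bdd _ m ρ B ((‖z‖ + ρ) ^ k) ?_ ?_ hm hB hs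
    · fun_prop
    · intro w hw
      rw [norm_pow, norm_mul, hN1, one_mul]
      gcongr
      linarith [norm_sub_le z w]
  have he : ∀ z w : ℂ, m w • ∑ k ∈ Finset.range (n+1), a k * (N w * (z - w)) ^ k =
      ∑ k ∈ Finset.range (n+1), a k * (m w • (N w * (z - w)) ^ k) := by
    intro z w
    rw [Finset.smul_sum]
    refine Finset.sum_congr rfl fun k _ => ?_
    rw [mul_smul_comm]
  choose P hP1 hP2 using poly_int1 N hN hN1 m ρ B hm hB hs
  refine ⟨⟨∑ k ∈ Finset.range (n+1), Polynomial.C (a k) * P k, ?_, ?_⟩, ?_⟩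
  · refine Polynomial.natDegree_sum_le_of_forall_le _ _ fun j hj => ?_
    refine (Polynomial.natDegree_C_mul_le _ _).trans ((hP1 j).trans ?_)
    have := Finset.mem_range.1 hj; omega
  · intro z
    simp only [he]
    rw [integral_finsetSum _ (fun k _ => (hi z k).const_mul _), Polynomial.eval_finsetSum]
    refine Finset.sum_congr rfl fun k _ => ?_
    rw [Polynomial.eval_mul, Polynomial.eval_C, hP2, integral_const_mul]
  · intro z
    simp only [he]
    exact integrable_finsetSum _ (fun k _ => (hi z k).const_mul _)

lemma sep_exists (K : Set ℂ) (hconv : Convex ℝ K) (hint : (interior K).Nonempty) (w : ℂ)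
    (hw : ¬ Metric.closedBall w 2 ⊆ interior K) :
    ∃ ν : ℂ, ‖ν‖ = 1 ∧ ∀ z ∈ K, (ν * (z - w)).re ≤ 2 := by
  rw [Set.not_subset] at hw
  obtain ⟨p, hp, hpK⟩ := hw
  obtain ⟨f, hf⟩ := geometric_hahn_banach_open_point hconv.interior isOpen_interior hpK
  have hrep : ∀ z : ℂ, f z = (((f 1 : ℂ) - (f Complex.I : ℂ) * Complex.I) * z).re := by
    intro z
    have : z = z.re • (1:ℂ) + z.im • Complex.I := by
      apply Complex.ext <;> simp
    conv_lhs => rw [this, map_add, map_smul, map_smul]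
    simp; ring
  set ν0 : ℂ := (f 1 : ℂ) - (f Complex.I : ℂ) * Complex.I with hν0
  have hne : ν0 ≠ 0 := by
    intro h
    obtain ⟨q, hq⟩ := hint
    have := hf q hq
    rw [hrep q, hrep p, h] at this
    simp at this
  have hpos : 0 < ‖ν0‖ := norm_pos_iff.2 hne
  have hK : ∀ z ∈ K, f z ≤ f p := by
    intro z hz
    have hz' : z ∈ closure (interior K) := by
      rw [hconv.closure_interior_eq_closure_of_nonempty_interior hint]
      exact subset_closure hz
    have hcl : IsClosed {z | f z ≤ f p} := isClosed_le f.continuous continuous_const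
    exact closure_minimal (fun q hq => (hf q hq).le) hcl hz'
  refine ⟨ν0 / (‖ν0‖ : ℂ), ?_, ?_⟩
  · rw [norm_div, Complex.norm_real, norm_norm, div_self hpos.ne']
  · intro z hz
    have e : ν0 / (‖ν0‖ : ℂ) * (z - w) = (ν0 * (z - p)) / (‖ν0‖ : ℂ) + ν0 / (‖ν0‖ : ℂ) * (p - w) := by ring
    rw [e, Complex.add_re, Complex.div_ofReal_re]
    have h1 : (ν0 * (z - p)).re ≤ 0 := by
      have := hK z hz
      rw [hrep z, hrep p] at this
      rw [mul_sub, Complex.sub_re]; linarith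
    have h2 : (ν0 / (‖ν0‖ : ℂ) * (p - w)).re ≤ 2 := by
      refine (Complex.re_le_norm _).trans ?_
      rw [norm_mul, norm_div, Complex.norm_real, norm_norm, div_self hpos.ne', one_mul]
      simpa [dist_eq_norm] using hp
    have h3 := div_nonpos_of_nonpos_of_nonneg h1 hpos.le
    linarith

lemma nu_exists (K : Set ℂ) (hconv : Convex ℝ K) (hint : (interior K).Nonempty) :
    ∃ N : ℂ → ℂ, Measurable N ∧ (∀ w, ‖N w‖ = 1) ∧
      ∀ w, ¬ Metric.closedBall w 2 ⊆ interior K → ∀ z ∈ K, (N w * (z - w)).re ≤ 4 := by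
  let cell : ℂ → ℤ × ℤ := fun w => (⌊w.re⌋, ⌊w.im⌋)
  have hcell : Measurable cell := by
    refine Measurable.prodMk ?_ ?_
    · exact Int.measurable_floor.comp Complex.measurable_re
    · exact Int.measurable_floor.comp Complex.measurable_im
  have key : ∀ p : ℤ × ℤ, ∃ ν : ℂ, ‖ν‖ = 1 ∧ ∀ w, cell w = p → ¬ Metric.closedBall w 2 ⊆ interior K →
      ∀ z ∈ K, (ν * (z - w)).re ≤ 4 := by
    intro p
    by_cases h : ∃ w0, cell w0 = p ∧ ¬ Metric.closedBall w0 2 ⊆ interior K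
    · obtain ⟨w0, h0, h1⟩ := h
      obtain ⟨ν, hν, hν2⟩ := sep_exists K hconv hint w0 h1
      refine ⟨ν, hν, fun w hw _ z hz => ?_⟩
      have e : ν * (z - w) = ν * (z - w0) + ν * (w0 - w) := by ring
      rw [e, Complex.add_re]
      have h2 := hν2 z hz
      have h3 : (ν * (w0 - w)).re ≤ 2 := by
        refine (Complex.re_le_norm _).trans ?_
        rw [norm_mul, hν, one_mul]
        refine (Complex.norm_le_abs_re_add_abs_im _).trans ?_
        have hh : cell w0 = cell w := h0.trans hw.symm
        have ha : ⌊w0.re⌋ = ⌊w.re⌋ := congrArg Prod.fst hh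
        have hb : ⌊w0.im⌋ = ⌊w.im⌋ := congrArg Prod.snd hh
        have ha' := Int.abs_sub_lt_one_of_floor_eq_floor ha
        have hb' := Int.abs_sub_lt_one_of_floor_eq_floor hb
        rw [Complex.sub_re, Complex.sub_im]
        linarith
      linarith
    · push Not at h
      exact ⟨1, by simp, fun w hw hw2 => absurd (h w hw) hw2⟩
  choose ν hν1 hν2 using key
  exact ⟨fun w => ν (cell w), (measurable_of_countable ν).comp hcell, fun w => hν1 _,
    fun w hw => hν2 _ w rfl hw⟩

open MeasureTheory in
lemma b_exists (C : ℝ) (hC : 0 ≤ C) : ∃ b : ℂ → ℝ, Integrable b ∧ (∀ y, 0 ≤ b y) ∧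
    (∀ y, ‖y‖ < 8 → |Real.log ‖y‖| + C * Real.exp 72 ≤ b y) ∧
    ∀ y, 8 ≤ ‖y‖ → C * Real.exp 4 / ‖y‖ ^ 3 ≤ b y := by
  set B := Metric.ball (0:ℂ) 8 with hB
  have hBm : MeasurableSet B := Metric.isOpen_ball.measurableSet
  have h1 : Integrable (B.indicator (fun y : ℂ => |Real.log ‖y‖| + C * Real.exp 72)) := by
    rw [integrable_indicator_iff hBm]
    have h2 := log_int 0 8
    simp only [sub_zero] at h2
    refine Integrable.add h2.abs ?_
    exact integrableOn_const measure_ball_lt_top.ne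
  have h2 : Integrable (fun y : ℂ => C * Real.exp 4 * 8 * (1 + ‖y‖) ^ (-(3:ℝ))) := by
    refine Integrable.const_mul ?_ _
    refine integrable_one_add_norm ?_
    rw [Complex.finrank_real_complex]; norm_num
  have n1 : ∀ y, 0 ≤ B.indicator (fun y : ℂ => |Real.log ‖y‖| + C * Real.exp 72) y := by
    intro y
    refine Set.indicator_nonneg (fun y _ => ?_) y
    positivity
  have n2 : ∀ y : ℂ, 0 ≤ C * Real.exp 4 * 8 * (1 + ‖y‖) ^ (-(3:ℝ)) := by
    intro y; positivity
  refine ⟨fun y => B.indicator (fun y : ℂ => |Real.log ‖y‖| + C * Real.exp 72) y +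
    C * Real.exp 4 * 8 * (1 + ‖y‖) ^ (-(3:ℝ)), h1.add h2, ?_, ?_, ?_⟩
  · intro y; exact add_nonneg (n1 y) (n2 y)
  · intro y hy
    have : y ∈ B := by simpa [hB] using hy
    simp only [Set.indicator_of_mem this]
    linarith [n2 y]
  · intro y hy
    refine le_trans ?_ (le_add_of_nonneg_left (n1 y))
    rw [Real.rpow_neg (by positivity), mul_assoc, div_eq_mul_inv]
    refine mul_le_mul_of_nonneg_left ?_ (by positivity)
    have e : (1 + ‖y‖) ^ (3:ℝ) = (1 + ‖y‖) ^ 3 := by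
      rw [← Real.rpow_natCast]; norm_num
    rw [e]
    have h3 : (1 + ‖y‖) ^ 3 ≤ (2 * ‖y‖) ^ 3 := by gcongr; linarith
    have hy0 : 0 < ‖y‖ := by linarith
    rw [← div_eq_mul_inv, le_div_iff₀ (by positivity), inv_mul_le_iff₀ (by positivity)]
    calc _ ≤ _ := h3
      _ = _ := by ring

lemma ptw (a : ℕ → ℂ) (C : ℝ) (hC : 0 ≤ C)
    (ha : ∀ k, ‖a k‖ ≤ C * 3 ^ k / (k.factorial : ℝ))
    (hk : ∀ z : ℂ, z.re ≤ 4 → 8 ≤ ‖z‖ → |Real.log ‖z‖ - (∑' k, a k * z ^ k).re| ≤ C * Real.exp z.re / ‖z‖ ^ 3)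
    (n : ℕ) (L : ℝ) (z : ℂ) (hL : ‖z‖ ≤ L) (hre : z.re ≤ 4) :
    (‖z‖ < 8 → |Real.log ‖z‖ - (∑ k ∈ Finset.range (n+1), a k * z ^ k).re| ≤
      |Real.log ‖z‖| + C * Real.exp 72 + C * Real.exp (-n) * Real.exp (9 * L)) ∧
    (8 ≤ ‖z‖ → |Real.log ‖z‖ - (∑ k ∈ Finset.range (n+1), a k * z ^ k).re| ≤
      C * Real.exp z.re / ‖z‖ ^ 3 + C * Real.exp (-n) * Real.exp (9 * L)) := by
  have ht : |(∑' k, a k * z ^ k).re - (∑ k ∈ Finset.range (n+1), a k * z ^ k).re| ≤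
      C * Real.exp (-n) * Real.exp (9 * L) := by
    rw [← Complex.sub_re]
    refine (Complex.abs_re_le_norm _).trans ((kern_tail a C hC ha z (n+1)).trans ?_)
    gcongr
    linarith
  constructor
  · intro h8
    have h0 : |(∑' k, a k * z ^ k).re| ≤ C * Real.exp 72 := by
      have := kern_tail a C hC ha z 0
      simp only [Finset.range_zero, Finset.sum_empty, sub_zero, Nat.cast_zero, neg_zero, Real.exp_zero, mul_one] at this
      refine (Complex.abs_re_le_norm _).trans (this.trans ?_)
      gcongr; linarith
    rw [abs_le] at *
    have h5 := neg_abs_le (Real.log ‖z‖)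
    have h6 := le_abs_self (Real.log ‖z‖)
    constructor <;> linarith
  · intro h8
    have h0 := hk z hre h8
    rw [abs_le] at *
    constructor <;> linarith

open MeasureTheory in
lemma main_core (K : Set ℂ) (f : ℂ → ℝ) (R M : ℝ) (hKc : IsCompact K)
    (hKR : K ⊆ Metric.closedBall 0 R) (hf : ContinuousOn f K) (hM0 : 0 ≤ M) (hM : ∀ z ∈ K, |f z| ≤ M)
    (hmv : ∀ z r, 0 ≤ r → Metric.closedBall z r ⊆ interior K → Real.circleAverage f z r = f z) :
    ∃ m : ℂ → ℝ, Measurable m ∧ (∀ w, |m w| ≤ 2 / (∫ y, phi y) * M) ∧ (∀ w, R + 3 ≤ ‖w‖ → m w = 0) ∧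
      (∀ w, Metric.closedBall w 2 ⊆ interior K → m w = 0) ∧
      (∀ z ∈ K, |f z - ∫ w, m w * Real.log ‖w - z‖| ≤ 2 * M) ∧
      (∀ z, Metric.closedBall z 2 ⊆ interior K → f z = ∫ w, m w * Real.log ‖w - z‖) := by
  classical
  set I := ∫ y, phi y with hI
  have hIpos : 0 < I := phi_pos
  set F : ℂ → ℝ := K.indicator f with hF
  have hFm : Measurable F := by
    have := ContinuousOn.measurable_piecewise (s := K) (f := f) (g := fun _ => (0:ℝ)) hf continuousOn_const hKc.measurableSet
    rw [hF, ← Set.piecewise_eq_indicator]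
    exact this
  have hFM : ∀ w, |F w| ≤ M := by
    intro w
    by_cases h : w ∈ K
    · simpa [hF, h] using hM w h
    · simpa [hF, h] using hM0
  have hFs : ∀ w, R + 1 ≤ ‖w‖ → F w = 0 := by
    intro w hw
    have : w ∉ K := fun h => by
      have := hKR h
      simp at this; linarith
    simp [hF, this]
  have hFK : ∀ z ∈ K, F z = f z := fun z hz => by simp [hF, hz]
  have hFmv : ∀ z r, 0 ≤ r → Metric.closedBall z r ⊆ interior K → Real.circleAverage F z r = f z := by
    intro z r hr h
    rw [← hmv z r hr h]
    refine Real.circleAverage_congr_sphere fun w hw => hFK w ?_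
    rw [abs_of_nonneg hr] at hw
    exact interior_subset (h (Metric.sphere_subset_closedBall hw))
  have hci : ∀ r w, |Real.circleAverage F w r| ≤ M := fun r w => circ_bound F r M hFM w
  have hcm : ∀ r, Measurable (fun w => Real.circleAverage F w r) := circ_meas F hFm
  have hcs : ∀ r, 0 ≤ r → r ≤ 2 → ∀ w, R + 3 ≤ ‖w‖ → Real.circleAverage F w r = 0 := by
    intro r hr hr2 w hw
    have : Real.circleAverage F w r = Real.circleAverage (fun _ => (0:ℝ)) w r := by
      refine Real.circleAverage_congr_sphere fun x hx => hFs x ?_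
      rw [abs_of_nonneg hr] at hx
      have h1 : ‖x - w‖ = r := by simpa [dist_eq_norm] using hx
      have h2 := norm_sub_norm_le w x
      rw [norm_sub_rev] at h2
      linarith
    rw [this, Real.circleAverage_const]
  have hint : ∀ r, 0 ≤ r → r ≤ 2 → ∀ z, Integrable (fun w => Real.log ‖w - z‖ * Real.circleAverage F w r) := by
    intro r hr hr2 z
    have := intg (fun w => Real.log ‖w - z‖) (fun w => Real.circleAverage F w r) (R+3) M
      (log_int z (R+3)) (hcm r) (hci r) (hcs r hr hr2)
    simpa [smul_eq_mul, mul_comm] using this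
  have hil : ∀ r, ∀ z, Integrable (fun y => F (z + y) * lr r y) := by
    intro r z
    have h1 : IntegrableOn (fun y => lr r y) (Metric.ball 0 (R + 1 + ‖z‖)) := by
      refine (ContinuousOn.integrableOn_compact (isCompact_closedBall (0:ℂ) (R + 1 + ‖z‖)) (lr_cont r).continuousOn).mono_set Metric.ball_subset_closedBall
    have := intg (fun y => lr r y) (fun y => F (z + y)) (R + 1 + ‖z‖) M h1 (by fun_prop) (fun y => hFM _) (by
      intro y hy
      apply hFs
      have h2 := norm_sub_le (z + y) z
      rw [add_sub_cancel_left] at h2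
      linarith)
    simpa [smul_eq_mul] using this
  have hv : ∀ z, ∫ w, (Real.circleAverage F w 2 - Real.circleAverage F w 1) / I * Real.log ‖w - z‖ =
      (∫ y, F (z + y) * phi y) / I := by
    intro z
    have h2 := fub F hFm M (R+1) 2 (by norm_num) hFM hFs z
    have h1 := fub F hFm M (R+1) 1 (by norm_num) hFM hFs z
    have e1 : ∫ y, F (z + y) * phi y = (∫ y, F (z + y) * lr 2 y) - ∫ y, F (z + y) * lr 1 y := by
      rw [← integral_sub (hil 2 z) (hil 1 z)]
      congr 1; funext y; rw [phi]; ring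
    rw [e1, h2, h1, ← integral_sub (hint 2 (by norm_num) le_rfl z) (hint 1 (by norm_num) (by norm_num) z),
      ← integral_div]
    congr 1; funext w; ring
  refine ⟨fun w => (Real.circleAverage F w 2 - Real.circleAverage F w 1) / I, ?_, ?_, ?_, ?_, ?_, ?_⟩
  · exact ((hcm 2).sub (hcm 1)).div_const I
  · intro w
    rw [abs_div, abs_of_pos hIpos, div_mul_eq_mul_div]
    refine div_le_div_of_nonneg_right ?_ hIpos.le
    refine (abs_sub _ _).trans ?_
    linarith [hci 2 w, hci 1 w]
  · intro w hw
    simp only [hcs 2 (by norm_num) le_rfl w hw, hcs 1 (by norm_num) (by norm_num) w hw]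
    simp
  · intro w hw
    simp only [hFmv w 2 (by norm_num) hw, hFmv w 1 (by norm_num) ((Metric.closedBall_subset_closedBall (by norm_num)).trans hw)]
    simp
  · intro z hz
    rw [hv]
    have : |(∫ y, F (z + y) * phi y) / I| ≤ M := by
      rw [abs_div, abs_of_pos hIpos, div_le_iff₀ hIpos, hI, ← integral_const_mul, ← Real.norm_eq_abs]
      refine norm_integral_le_of_norm_le (phi_int.const_mul M) (Eventually.of_forall fun y => ?_)
      rw [norm_mul, Real.norm_of_nonneg (phi_nonneg y)]
      exact mul_le_mul_of_nonneg_right (hFM _) (phi_nonneg y)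
    refine (abs_sub _ _).trans ?_
    linarith [hM z hz]
  · intro z hz
    have hzK : z ∈ K := interior_subset (hz (Metric.mem_closedBall_self (by norm_num)))
    rw [hv, meanphi F hFm M hFM z, hFK z hzK, mul_div_assoc, div_self hIpos.ne', mul_one]
    intro r hr hr2
    rw [hFK z hzK]
    exact hFmv z r hr ((Metric.closedBall_subset_closedBall hr2).trans hz)

open MeasureTheory in
lemma main_scale : ∃ C0 : ℝ, 0 ≤ C0 ∧ ∀ (K : Set ℂ) (f : ℂ → ℝ) (R M : ℝ) (n : ℕ), IsCompact K →
    Convex ℝ K → (interior K).Nonempty → 0 ≤ R → K ⊆ Metric.closedBall 0 R → ContinuousOn f K →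
    (∀ z ∈ K, |f z| ≤ M) →
    (∀ z r, 0 ≤ r → Metric.closedBall z r ⊆ interior K → Real.circleAverage f z r = f z) →
    ∃ P : Polynomial ℂ, P.natDegree ≤ n ∧
      (∀ z ∈ K, |f z - (P.eval z).re| ≤ C0 * M * (1 + (R+3)^2 * Real.exp (-n) * Real.exp (9 * (2*R+3)))) ∧
      (∀ z d, 12 ≤ d → Metric.closedBall z d ⊆ interior K →
        |f z - (P.eval z).re| ≤ C0 * M * ((R+3)^2 * Real.exp (-d) + (R+3)^2 * Real.exp (-n) * Real.exp (9 * (2*R+3)))) := by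
  obtain ⟨a, C, hC, ha, hk⟩ := kernel_exists
  obtain ⟨b, hbi, hb0, hb1, hb2⟩ := b_exists C hC
  set I := ∫ y, phi y with hI
  have hIpos : 0 < I := phi_pos
  have hJ : 0 ≤ ∫ y, b y := integral_nonneg hb0
  set J := ∫ y, b y with hJd
  set A := 2 / I with hA
  have hApos : 0 < A := by positivity
  refine ⟨2 + A * (J + C * Real.exp 4 * Real.pi + C * Real.pi), by positivity, ?_⟩
  intro K f R M n hKc hconv hint hR hKR hf hM hmv
  have hM0 : 0 ≤ M := by
    obtain ⟨p, hp⟩ := hint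
    exact (abs_nonneg _).trans (hM p (interior_subset hp))
  obtain ⟨m, hm, hmB, hms, hmi, hv1, hv2⟩ := main_core K f R M hKc hKR hf hM0 hM hmv
  obtain ⟨N, hN, hN1, hN2⟩ := nu_exists K hconv hint
  obtain ⟨⟨P, hP1, hP2⟩, hPi⟩ := poly_int a n N hN hN1 m (R+3) _ hm hmB hms
  set L := 2 * R + 3 with hL
  set B := Metric.ball (0:ℂ) (R+3) with hB
  have hBm : MeasurableSet B := Metric.isOpen_ball.measurableSet
  set t := C * Real.exp (-n) * Real.exp (9 * L) with ht
  have ht0 : 0 ≤ t := by positivity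
  set S : ℂ → ℂ := fun ζ => ∑ k ∈ Finset.range (n+1), a k * ζ ^ k with hS
  have hvol : (volume B).toReal = Real.pi * (R+3)^2 := by
    rw [hB, Complex.volume_ball]
    rw [ENNReal.toReal_mul, ENNReal.toReal_pow, ENNReal.toReal_ofReal (by positivity)]
    simp [mul_comm]
  have hconstI : ∀ c : ℝ, Integrable (B.indicator (fun _ => c)) := fun c =>
    (integrable_indicator_iff hBm).2 (integrableOn_const measure_ball_lt_top.ne)
  have hconst : ∀ c : ℝ, ∫ w, B.indicator (fun _ => c) w = c * (Real.pi * (R+3)^2) := by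
    intro c
    rw [integral_indicator hBm, setIntegral_const, smul_eq_mul, Measure.real, hvol, mul_comm]
  have hli : ∀ z, Integrable (fun w => m w * Real.log ‖w - z‖) := by
    intro z
    have := intg (fun w => Real.log ‖w - z‖) m (R+3) _ (log_int z (R+3)) hm hmB hms
    simpa [smul_eq_mul] using this
  have hre : ∀ z, (P.eval z).re = ∫ w, m w * (S (N w * (z - w))).re := by
    intro z
    rw [hP2 z]
    have := integral_re (hPi z)
    simp only [RCLike.re_eq_complex_re] at this
    rw [← this]
    congr 1; funext w
    rw [Complex.smul_re, smul_eq_mul]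
  have hri : ∀ z, Integrable (fun w => m w * (S (N w * (z - w))).re) := by
    intro z
    have := (hPi z).re
    refine this.congr (Eventually.of_forall fun w => ?_)
    simp only [RCLike.re_eq_complex_re]
    rw [Complex.smul_re, smul_eq_mul]
  have hdiff : ∀ z, (∫ w, m w * Real.log ‖w - z‖) - (P.eval z).re =
      ∫ w, m w * (Real.log ‖w - z‖ - (S (N w * (z - w))).re) := by
    intro z
    rw [hre z, ← integral_sub (hli z) (hri z)]
    congr 1; funext w; ring
  have hn : ∀ z w, ‖N w * (z - w)‖ = ‖w - z‖ := by
    intro z w; rw [norm_mul, hN1, one_mul, norm_sub_rev]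
  have hwB : ∀ w, m w ≠ 0 → w ∈ B := by
    intro w hw
    by_contra h
    exact hw (hms w (by simpa [hB] using h))
  have hwL : ∀ z ∈ K, ∀ w ∈ B, ‖N w * (z - w)‖ ≤ L := by
    intro z hz w hw
    rw [hn]
    have h1 : ‖z‖ ≤ R := by simpa using hKR hz
    have h2 : ‖w‖ < R + 3 := by simpa [hB] using hw
    linarith [norm_sub_le w z]
  have hwK : ∀ w, m w ≠ 0 → ¬ Metric.closedBall w 2 ⊆ interior K := fun w hw h => hw (hmi w h)
  have htA : A * M * (t * (Real.pi * (R+3)^2)) = A * (C * Real.pi) * M * ((R+3)^2 * Real.exp (-n) * Real.exp (9 * L)) := by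
    rw [ht]; ring
  have hq0 : 0 ≤ (R+3)^2 * Real.exp (-n) * Real.exp (9 * L) := by positivity
  set q := (R+3)^2 * Real.exp (-n) * Real.exp (9 * L) with hq
  refine ⟨P, hP1, ?_, ?_⟩
  · intro z hz
    have hpt : ∀ w, ‖m w * (Real.log ‖w - z‖ - (S (N w * (z - w))).re)‖ ≤
        A * M * (b (w - z) + B.indicator (fun _ => t) w) := by
      intro w
      by_cases hw : m w = 0
      · rw [hw, zero_mul, norm_zero]
        have : 0 ≤ B.indicator (fun _ => t) w := Set.indicator_nonneg (fun _ _ => ht0) w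
        have := hb0 (w - z)
        positivity
      · rw [norm_mul]
        have h1 := hwB w hw
        rw [Set.indicator_of_mem h1]
        refine mul_le_mul (hmB w) ?_ (norm_nonneg _) (by positivity)
        have h4 := hN2 w (hwK w hw) z hz
        obtain ⟨p1, p2⟩ := ptw a C hC ha hk n L _ (hwL z hz w h1) h4
        rw [Real.norm_eq_abs]
        rw [hn] at p1 p2
        rcases lt_or_ge ‖w - z‖ 8 with h8 | h8
        · refine (p1 h8).trans ?_
          gcongr
          exact hb1 _ h8
        · refine (p2 h8).trans ?_
          gcongr
          refine le_trans ?_ (hb2 _ h8)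
          gcongr
    have hbz : Integrable (fun w => b (w - z)) := hbi.comp_sub_right z
    have hbd : |(∫ w, m w * Real.log ‖w - z‖) - (P.eval z).re| ≤ A * M * (J + t * (Real.pi * (R+3)^2)) := by
      rw [hdiff z, ← Real.norm_eq_abs]
      refine (norm_integral_le_of_norm_le ((hbz.add (hconstI t)).const_mul (A * M)) (Eventually.of_forall hpt)).trans ?_
      rw [integral_const_mul]
      have : ∫ w, ((fun w => b (w - z)) + B.indicator (fun _ => t)) w = J + t * (Real.pi * (R+3)^2) := by
        rw [integral_add' hbz (hconstI t), hconst, integral_sub_right_eq_self b z]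
      rw [this]
    have h1 := hv1 z hz
    have h2 := abs_sub_le (f z) (∫ w, m w * Real.log ‖w - z‖) ((P.eval z).re)
    have hAM : 0 ≤ A * M := by positivity
    have h3 : 0 ≤ (2 + A * (J + C * Real.exp 4 * Real.pi)) * M * q := by positivity
    have h4 : 0 ≤ A * (C * Real.exp 4 * Real.pi + C * Real.pi) * M := by positivity
    rw [mul_add, htA] at hbd
    nlinarith
  · intro z d hd hz
    have hzK : z ∈ K := interior_subset (hz (Metric.mem_closedBall_self (by linarith)))
    have hpt : ∀ w, ‖m w * (Real.log ‖w - z‖ - (S (N w * (z - w))).re)‖ ≤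
        A * M * B.indicator (fun _ => C * Real.exp 4 * Real.exp (-d) + t) w := by
      intro w
      by_cases hw : m w = 0
      · rw [hw, zero_mul, norm_zero]
        have : 0 ≤ B.indicator (fun _ => C * Real.exp 4 * Real.exp (-d) + t) w := Set.indicator_nonneg (fun _ _ => by positivity) w
        positivity
      · rw [norm_mul]
        have h1 := hwB w hw
        rw [Set.indicator_of_mem h1]
        refine mul_le_mul (hmB w) ?_ (norm_nonneg _) (by positivity)
        have h4 : (N w * (z - w)).re ≤ 4 - d := by
          have hz' : z + d * (starRingEnd ℂ) (N w) ∈ K := by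
            apply interior_subset; apply hz
            simp [dist_eq_norm, hN1, abs_of_nonneg (show (0:ℝ) ≤ d by linarith)]
          have h5 := hN2 w (hwK w hw) _ hz'
          have e : N w * (z + d * (starRingEnd ℂ) (N w) - w) = N w * (z - w) + d := by
            have : N w * (starRingEnd ℂ) (N w) = 1 := by
              rw [Complex.mul_conj, Complex.normSq_eq_norm_sq, hN1]; simp
            linear_combination (d:ℂ) * this
          rw [e, Complex.add_re, Complex.ofReal_re] at h5
          linarith
        obtain ⟨p1, p2⟩ := ptw a C hC ha hk n L _ (hwL z hzK w h1) (by linarith)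
        have h8 : 8 ≤ ‖N w * (z - w)‖ := by
          have := Complex.abs_re_le_norm (N w * (z - w))
          have := neg_abs_le (N w * (z - w)).re
          linarith
        have p3 := p2 h8
        rw [Real.norm_eq_abs, ← hn z w]
        refine p3.trans ?_
        gcongr
        have h9 : C * Real.exp (N w * (z - w)).re ≤ C * Real.exp 4 * Real.exp (-d) := by
          rw [mul_assoc, ← Real.exp_add]
          gcongr
          linarith
        refine le_trans (div_le_self (by positivity) ?_) h9
        exact one_le_pow₀ (by linarith)
    have hbd : |(∫ w, m w * Real.log ‖w - z‖) - (P.eval z).re| ≤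
        A * M * ((C * Real.exp 4 * Real.exp (-d) + t) * (Real.pi * (R+3)^2)) := by
      rw [hdiff z, ← Real.norm_eq_abs]
      refine (norm_integral_le_of_norm_le ((hconstI _).const_mul (A * M)) (Eventually.of_forall hpt)).trans ?_
      rw [integral_const_mul, hconst]
    rw [← hv2 z ((Metric.closedBall_subset_closedBall (by linarith)).trans hz)] at hbd
    refine hbd.trans ?_
    set s := (R+3)^2 * Real.exp (-d) with hs
    have hs0 : 0 ≤ s := by positivity
    have e : A * M * ((C * Real.exp 4 * Real.exp (-d) + t) * (Real.pi * (R+3)^2)) =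
      A * (C * Real.exp 4 * Real.pi) * M * s + A * (C * Real.pi) * M * q := by
      rw [add_mul, mul_add, htA, hs]; ring
    rw [e]
    have h3 : 0 ≤ (2 + A * (J + C * Real.exp 4 * Real.pi)) * M * q := by positivity
    have h4 : 0 ≤ (2 + A * (J + C * Real.pi)) * M * s := by positivity
    nlinarith

lemma mv (U : Set ℂ) (f : ℂ → ℝ) (h : ∀ z ∈ U, ∃ r : ℝ, 0 < r ∧ ∃ g : ℂ → ℂ,
      DifferentiableOn ℂ g (Metric.ball z r) ∧ ∀ w ∈ Metric.ball z r, f w = (g w).re)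
    (z : ℂ) (r : ℝ) (hr : 0 ≤ r) (hz : Metric.closedBall z r ⊆ U) : Real.circleAverage f z r = f z := by
  apply InnerProductSpace.HarmonicOnNhd.circleAverage_eq
  rw [abs_of_nonneg hr]
  intro x hx
  obtain ⟨s, hs, g, hg, hfg⟩ := h x (hz hx)
  have hb : Metric.ball x s ∈ nhds x := Metric.ball_mem_nhds x hs
  have han : AnalyticAt ℂ g x := hg.analyticAt hb
  refine (InnerProductSpace.harmonicAt_congr_nhds ?_).2 han.harmonicAt_re
  filter_upwards [hb] with w hw using hfg w hw

lemma supErr_ge (u : ℂ → ℝ) (K : Set ℂ) (hK : IsCompact K) (hu : ContinuousOn u K) (P : Polynomial ℂ) (z : ℂ)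
    (hz : z ∈ K) : |u z - (P.eval z).re| ≤ supErrH u K P := by
  have hc : ContinuousOn (fun z => |u z - (P.eval z).re|) K := by
    refine (hu.sub ?_).abs
    exact (Complex.continuous_re.comp P.continuous).continuousOn
  have hb := (hK.image_of_continuousOn hc).bddAbove
  rw [Set.image_eq_range] at hb
  exact le_ciSup hb (⟨z, hz⟩ : K)

lemma supErr_nonneg (u : ℂ → ℝ) (K : Set ℂ) (P : Polynomial ℂ) : 0 ≤ supErrH u K P :=
  Real.iSup_nonneg fun _ => abs_nonneg _

lemma best_nonneg (u : ℂ → ℝ) (K : Set ℂ) (n : ℕ) : 0 ≤ bestEH u K n :=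
  Real.iInf_nonneg fun _ => supErr_nonneg _ _ _

lemma best_bdd (u : ℂ → ℝ) (K : Set ℂ) (n : ℕ) : bestEH u K n ≤ supErrH u K 0 := by
  have hb : BddBelow (Set.range fun P : {P : Polynomial ℂ // P.natDegree ≤ n} => supErrH u K P.1) :=
    ⟨0, by rintro _ ⟨P, rfl⟩; exact supErr_nonneg _ _ _⟩
  exact ciInf_le hb (⟨0, by simp⟩ : {P : Polynomial ℂ // P.natDegree ≤ n})

lemma best_approx (u : ℂ → ℝ) (K : Set ℂ) (hK : IsCompact K) (hu : ContinuousOn u K) (n : ℕ) :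
    ∃ Q : Polynomial ℂ, Q.natDegree ≤ n ∧ ∀ z ∈ K, |u z - (Q.eval z).re| ≤ 2 * bestEH u K n := by
  have : Nonempty {P : Polynomial ℂ // P.natDegree ≤ n} := ⟨⟨0, by simp⟩⟩
  have hlt : ∀ ε, bestEH u K n < ε → ∃ Q : Polynomial ℂ, Q.natDegree ≤ n ∧ ∀ z ∈ K, |u z - (Q.eval z).re| < ε := by
    intro ε hε
    obtain ⟨Q, hQ⟩ := exists_lt_of_ciInf_lt hε
    exact ⟨Q.1, Q.2, fun z hz => (supErr_ge u K hK hu Q.1 z hz).trans_lt hQ⟩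
  rcases (best_nonneg u K n).lt_or_eq with h | h
  · obtain ⟨Q, h1, h2⟩ := hlt (2 * bestEH u K n) (by linarith)
    exact ⟨Q, h1, fun z hz => (h2 z hz).le⟩
  · rw [← h] at hlt ⊢
    have : CompactSpace K := isCompact_iff_compactSpace.1 hK
    let T : (Fin (n+1) → ℂ) →ₗ[ℝ] C(K, ℝ) :=
      { toFun := fun c => ⟨fun z => (∑ k, c k * (z:ℂ) ^ (k:ℕ)).re, by fun_prop⟩
        map_add' := by
          intro c d; ext z
          simp [add_mul, Finset.sum_add_distrib]
        map_smul' := by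
          intro r c; ext z
          simp [mul_assoc]
          rw [← Finset.mul_sum, Finset.sum_sub_distrib] }
    have hcl : IsClosed (LinearMap.range T : Set C(K, ℝ)) := Submodule.closed_of_finiteDimensional _
    let U : C(K, ℝ) := ⟨fun z => u z, hu.domRestrict⟩
    have hU : U ∈ closure (LinearMap.range T : Set C(K, ℝ)) := by
      rw [Metric.mem_closure_iff]
      intro ε hε
      obtain ⟨Q, h1, h2⟩ := hlt ε hε
      refine ⟨T (fun k => Q.coeff k), ⟨_, rfl⟩, ?_⟩
      rw [ContinuousMap.dist_lt_iff hε]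
      intro z
      have := h2 z z.2
      rw [Polynomial.eval_eq_sum_range' (Nat.lt_succ_of_le h1), Finset.sum_range] at this
      exact this
    rw [hcl.closure_eq] at hU
    obtain ⟨c, hc⟩ := hU
    refine ⟨∑ k : Fin (n+1), Polynomial.monomial (k:ℕ) (c k), ?_, ?_⟩
    · refine Polynomial.natDegree_sum_le_of_forall_le _ _ fun j hj => ?_
      exact (Polynomial.natDegree_monomial_le _).trans (by omega)
    · intro z hz
      have := DFunLike.congr_fun hc (⟨z, hz⟩ : K)
      have e : (∑ k, c k * z ^ (k:ℕ)).re = u z := this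
      rw [Polynomial.eval_finsetSum]
      simp only [Polynomial.eval_monomial]
      rw [e]; simp

open Pointwise in
lemma per_n (K : Set ℂ) (hKc : IsCompact K) (hKconv : Convex ℝ K)
    (hKint : (interior K).Nonempty) (u : ℂ → ℝ)
    (hu_cont : ContinuousOn u K)
    (hu_harm : ∀ z ∈ interior K, ∃ r : ℝ, 0 < r ∧ ∃ g : ℂ → ℂ,
      DifferentiableOn ℂ g (Metric.ball z r) ∧
      ∀ w ∈ Metric.ball z r, u w = (g w).re) :
    ∃ C κ : ℝ, 0 ≤ C ∧ 0 < κ ∧ ∀ n : ℕ, 1 ≤ n → ∃ P : Polynomial ℂ, P.natDegree ≤ n ∧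
      (∀ z ∈ K, |u z - (P.eval z).re| ≤ C * bestEH u K n) ∧
      ∀ z d, 0 < d → 12 ≤ κ * n * d → Metric.closedBall z d ⊆ interior K → |u z - (P.eval z).re| ≤
        C * bestEH u K n * (((n:ℝ)/36+3)^2 * Real.exp (-(κ * n * d)) + Real.exp (-((n:ℝ)/4))) := by
  obtain ⟨C0, hC0, hmain⟩ := main_scale
  obtain ⟨R1, hR1⟩ := hKc.isBounded.subset_closedBall (0:ℂ)
  set R0 := max R1 1 with hR0
  have hR0pos : 0 < R0 := lt_of_lt_of_le one_pos (le_max_right _ _)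
  have hKR0 : K ⊆ Metric.closedBall 0 R0 := hR1.trans (Metric.closedBall_subset_closedBall (le_max_left _ _))
  set D := 9 * Real.exp 27 with hD
  have hD1 : 1 ≤ D := by
    have := Real.one_le_exp (x := 27) (by norm_num)
    rw [hD]; linarith
  refine ⟨C0 * 2 * (1 + D), 1 / (36 * R0), by positivity, by positivity, ?_⟩
  intro n hn
  have hn' : (1:ℝ) ≤ n := by exact_mod_cast hn
  set κ := 1 / (36 * R0) with hκ
  have hκpos : 0 < κ := by positivity
  set lam := κ * n with hlam
  have hlpos : 0 < lam := by positivity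
  have hlR : lam * R0 = n / 36 := by
    rw [hlam, hκ]; field_simp
  obtain ⟨Q, hQ1, hQ2⟩ := best_approx u K hKc hu_cont n
  have hbn := best_nonneg u K n
  set M := bestEH u K n with hM
  have hl0 : lam ≠ 0 := hlpos.ne'
  set f : ℂ → ℝ := fun y => u (lam⁻¹ • y) - (Q.eval (lam⁻¹ • y)).re with hf
  have hmem : ∀ y, y ∈ lam • K ↔ lam⁻¹ • y ∈ K := Set.mem_smul_set_iff_inv_smul_mem₀ hl0 K
  have hintl : interior (lam • K) = lam • interior K := interior_smul₀ hl0 K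
  have hτ : ((n:ℝ)/36+3)^2 * Real.exp (-n) * Real.exp (9 * (2*((n:ℝ)/36)+3)) ≤ D * Real.exp (-((n:ℝ)/4)) := by
    have h1 : (n:ℝ)/36+3 ≤ 3 * Real.exp (n/108) := by
      have := Real.add_one_le_exp ((n:ℝ)/108); linarith
    calc _ ≤ (3 * Real.exp (n/108))^2 * Real.exp (-n) * Real.exp (9 * (2*((n:ℝ)/36)+3)) := by gcongr
      _ = 9 * (Real.exp (n/108) * Real.exp (n/108) * Real.exp (-n) * Real.exp (9 * (2*((n:ℝ)/36)+3))) := by ring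
      _ = 9 * Real.exp (n/108 + n/108 + -n + 9 * (2*((n:ℝ)/36)+3)) := by
        rw [← Real.exp_add, ← Real.exp_add, ← Real.exp_add]
      _ ≤ 9 * Real.exp (27 + -((n:ℝ)/4)) :=
        mul_le_mul_of_nonneg_left (Real.exp_le_exp.2 (by linarith)) (by norm_num)
      _ = _ := by rw [Real.exp_add, hD]; ring
  obtain ⟨q, hq1, hq2, hq3⟩ := hmain (lam • K) f (n/36) (2 * M) n (hKc.smul lam) (hKconv.smul lam) (by
      rw [hintl]; exact hKint.smul_set) (by positivity) (by
      rw [← hlR]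
      intro y hy
      have := hKR0 ((hmem y).1 hy)
      simp only [mem_closedBall_zero_iff, norm_smul, norm_inv, Real.norm_of_nonneg hlpos.le] at this ⊢
      rwa [inv_mul_le_iff₀ hlpos] at this) (by
      have h1 : ContinuousOn (fun y : ℂ => lam⁻¹ • y) (lam • K) := (continuous_const_smul _).continuousOn
      have h2 : Set.MapsTo (fun y : ℂ => lam⁻¹ • y) (lam • K) K := fun y hy => (hmem y).1 hy
      refine (hu_cont.comp h1 h2).sub ?_
      exact (Complex.continuous_re.comp (Q.continuous.comp (continuous_const_smul _))).continuousOn) (by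
      intro y hy
      exact hQ2 _ ((hmem y).1 hy)) (by
      refine mv _ f ?_
      intro y hy
      rw [hintl, Set.mem_smul_set_iff_inv_smul_mem₀ hl0] at hy
      obtain ⟨r, hr, g, hg1, hg2⟩ := hu_harm _ hy
      have hmt : Set.MapsTo (fun w : ℂ => lam⁻¹ • w) (Metric.ball y (lam * r)) (Metric.ball (lam⁻¹ • y) r) := by
        intro w hw
        rw [Metric.mem_ball, dist_smul₀, norm_inv, Real.norm_of_nonneg hlpos.le, inv_mul_lt_iff₀ hlpos]
        exact hw
      have hdl : Differentiable ℂ (fun w : ℂ => lam⁻¹ • w) := by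
        have e : (fun w : ℂ => lam⁻¹ • w) = fun w : ℂ => ((lam⁻¹ : ℝ) : ℂ) * w := by
          funext w; rw [Complex.real_smul]
        rw [e]; fun_prop
      refine ⟨lam * r, by positivity, fun w => g (lam⁻¹ • w) - Q.eval (lam⁻¹ • w), ?_, ?_⟩
      · refine (hg1.comp hdl.differentiableOn hmt).sub ?_
        exact (Q.differentiable.comp hdl).differentiableOn
      · intro w hw
        simp only [hf, Complex.sub_re, hg2 _ (hmt hw)])
  have hcan : ∀ z : ℂ, lam⁻¹ • (lam • z) = z := fun z => inv_smul_smul₀ hl0 z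
  have hfe : ∀ z : ℂ, u z - ((Q + q.comp (Polynomial.C (lam:ℂ) * Polynomial.X)).eval z).re =
      f (lam • z) - (q.eval (lam • z)).re := by
    intro z
    simp only [hf, hcan]
    simp only [Polynomial.eval_add, Polynomial.eval_comp, Polynomial.eval_mul, Polynomial.eval_C,
      Polynomial.eval_X, Complex.add_re, Complex.real_smul]
    ring
  refine ⟨Q + q.comp (Polynomial.C (lam:ℂ) * Polynomial.X), ?_, ?_, ?_⟩
  · refine Polynomial.natDegree_add_le_of_degree_le hQ1 ?_
    refine Polynomial.natDegree_comp_le.trans ?_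
    calc _ ≤ q.natDegree * 1 := by
          gcongr
          exact (Polynomial.natDegree_C_mul_le _ _).trans Polynomial.natDegree_X_le
      _ ≤ n := by omega
  · intro z hz
    rw [hfe]
    refine (hq2 _ (Set.smul_mem_smul_set hz)).trans ?_
    have h1 : D * Real.exp (-((n:ℝ)/4)) ≤ D * 1 := by
      gcongr
      exact Real.exp_le_one_iff.2 (by linarith)
    calc _ ≤ C0 * (2 * M) * (1 + D) := by gcongr; linarith
      _ = _ := by ring
  · intro z d hd hd12 hz
    rw [hfe]
    have hz' : Metric.closedBall (lam • z) (lam * d) ⊆ interior (lam • K) := by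
      rw [hintl]
      have := smul_closedBall lam z hd.le
      rw [Real.norm_of_nonneg hlpos.le] at this
      rw [← this]
      exact Set.smul_set_mono hz
    refine (hq3 _ _ hd12 hz').trans ?_
    calc _ ≤ C0 * (2 * M) * (((n:ℝ)/36+3)^2 * Real.exp (-(lam * d)) + D * Real.exp (-((n:ℝ)/4))) := by gcongr
      _ ≤ C0 * (2 * M) * ((1 + D) * (((n:ℝ)/36+3)^2 * Real.exp (-(lam * d))) + (1 + D) * Real.exp (-((n:ℝ)/4))) := by
        refine mul_le_mul_of_nonneg_left (add_le_add ?_ ?_) (by positivity)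
        · exact le_mul_of_one_le_left (by positivity) (by linarith)
        · exact mul_le_mul_of_nonneg_right (by linarith) (Real.exp_pos _).le
      _ = _ := by ring

theorem stmt_1 (K : Set ℂ) (hKc : IsCompact K) (hKconv : Convex ℝ K)
    (hKint : (interior K).Nonempty) (u : ℂ → ℝ)
    (hu_cont : ContinuousOn u K)
    (hu_harm : ∀ z ∈ interior K, ∃ r : ℝ, 0 < r ∧ ∃ g : ℂ → ℂ,
      DifferentiableOn ℂ g (Metric.ball z r) ∧
      ∀ w ∈ Metric.ball z r, u w = (g w).re) :
    ∃ (C : ℝ) (P : ℕ → Polynomial ℂ), 1 ≤ C ∧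
      (∀ n : ℕ, 1 ≤ n → (P n).natDegree ≤ n) ∧
      (∀ n : ℕ, 1 ≤ n → ∀ z ∈ K,
        |u z - ((P n).eval z).re| ≤ C * bestEH u K n) ∧
      (∀ E : Set ℂ, IsCompact E → E ⊆ interior K → ∃ c : ℝ, 0 < c ∧
        Tendsto (fun n : ℕ => Real.exp (c * n) * supErrH u E (P n)) atTop (nhds 0)) := by
  obtain ⟨C, κ, hC, hκ, hper⟩ := per_n K hKc hKconv hKint u hu_cont hu_harm
  choose! P hP1 hP2 hP3 using hper
  refine ⟨C + 1, P, by linarith, hP1, ?_, ?_⟩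
  · intro n hn z hz
    refine (hP2 n hn z hz).trans ?_
    exact mul_le_mul_of_nonneg_right (by linarith) (best_nonneg u K n)
  · intro E hE hEK
    obtain ⟨d, hd, hdE⟩ := hE.exists_cthickening_subset_open isOpen_interior hEK
    have hball : ∀ z ∈ E, Metric.closedBall z d ⊆ interior K := fun z hz =>
      (Metric.closedBall_subset_cthickening hz d).trans hdE
    set δ := κ * d / 4 with hδ
    have hδpos : 0 < δ := by positivity
    set c := min δ (1/8) with hc
    have hcpos : 0 < c := lt_min hδpos (by norm_num)
    have hc1 : c ≤ δ := min_le_left _ _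
    have hc2 : c ≤ 1/8 := min_le_right _ _
    set S := supErrH u K 0 with hS
    have hS0 : 0 ≤ S := supErr_nonneg _ _ _
    set G := (3 + 1/(36*δ))^2 with hG
    have hG0 : 0 ≤ G := by positivity
    refine ⟨c, hcpos, ?_⟩
    have hlim : Tendsto (fun n : ℕ => C * S * (G + 1) * Real.exp (-(c * n))) atTop (nhds 0) := by
      rw [← mul_zero (C * S * (G + 1))]
      refine Tendsto.const_mul _ ?_
      refine Real.tendsto_exp_neg_atTop_nhds_zero.comp ?_
      exact tendsto_natCast_atTop_atTop.const_mul_atTop hcpos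
    have hev : ∀ᶠ n : ℕ in atTop, 1 ≤ n ∧ 12 ≤ κ * n * d := by
      refine (eventually_ge_atTop 1).and ?_
      have : Tendsto (fun n : ℕ => κ * n * d) atTop atTop :=
        (tendsto_natCast_atTop_atTop.const_mul_atTop hκ).atTop_mul_const hd
      exact this.eventually_ge_atTop 12
    refine squeeze_zero' (Eventually.of_forall fun n => mul_nonneg (Real.exp_pos _).le (supErr_nonneg _ _ _)) ?_ hlim
    filter_upwards [hev] with n ⟨hn, h12⟩
    have hn0 : (0:ℝ) ≤ n := Nat.cast_nonneg n
    have hb0 := best_nonneg u K n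
    have hb1 := best_bdd u K n
    have hsq : ((n:ℝ)/36+3)^2 ≤ G * Real.exp (2 * δ * n) := by
      have h1 : (n:ℝ)/36 + 3 ≤ (3 + 1/(36*δ)) * Real.exp (δ * n) := by
        have h2 := Real.add_one_le_exp (δ * n)
        have h3 : 1 ≤ Real.exp (δ * n) := Real.one_le_exp (by positivity)
        have h4 : (n:ℝ)/36 = 1/(36*δ) * (δ * n) := by field_simp
        rw [h4, add_mul]
        have h5 : 1/(36*δ) * (δ * n) ≤ 1/(36*δ) * Real.exp (δ * n) := by gcongr; linarith
        linarith
      calc _ ≤ ((3 + 1/(36*δ)) * Real.exp (δ * n))^2 := by gcongr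
        _ = G * (Real.exp (δ * n) * Real.exp (δ * n)) := by ring
        _ = _ := by rw [← Real.exp_add]; congr 2; ring
    have hb : supErrH u E (P n) ≤ C * S * (G + 1) * Real.exp (-(2 * c * n)) := by
      refine Real.iSup_le (fun z => ?_) (by positivity)
      refine (hP3 n hn z d hd h12 (hball z z.2)).trans ?_
      have e1 : ((n:ℝ)/36+3)^2 * Real.exp (-(κ * n * d)) ≤ G * Real.exp (-(2 * c * n)) := by
        calc _ ≤ G * Real.exp (2 * δ * n) * Real.exp (-(κ * n * d)) := by gcongr
          _ = G * Real.exp (-(2 * δ * n)) := by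
            rw [mul_assoc, ← Real.exp_add]; congr 2; rw [hδ]; ring
          _ ≤ _ := by gcongr
      have e2 : Real.exp (-((n:ℝ)/4)) ≤ Real.exp (-(2 * c * n)) := by
        gcongr; nlinarith
      calc _ ≤ C * S * (G * Real.exp (-(2 * c * n)) + Real.exp (-(2 * c * n))) := by gcongr
        _ = _ := by ring
    calc _ ≤ Real.exp (c * n) * (C * S * (G + 1) * Real.exp (-(2 * c * n))) := by gcongr
      _ = C * S * (G + 1) * (Real.exp (c * n) * Real.exp (-(2 * c * n))) := by ring
      _ = _ := by rw [← Real.exp_add]; congr 2; ring
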